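/- arXiv:2211.11475 — 2 statements merged into one kernel-verified Lean document; each statement's English description precedes it below -/
import Mathlib

section
/- Fix angles φ, ϕ ∈ (0, π) and positive constants σ_φ², σ_ϕ², A_φ, A_ϕ, C. With σ̃_φ²(t) = σ_φ²·A_φ/(σ_φ²·t + A_φ), σ̃_ϕ²(t) = σ_ϕ²·A_ϕ/(σ_ϕ²·t + A_ϕ), and R̃^C(t) = log₂(1 + C · h̃(φ, σ̃_φ²(t)) · h̃(ϕ, σ̃_ϕ²(t))), the joint-sensing-and-communication-stage rate satisfies, for every β ∈ [0, 1] and every t ≥ 0: log₂(1 + C·(1 − β)·h̃(φ, σ_φ²)·h̃(ϕ, σ_ϕ²)) ≤ R̃^C(t). -/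
/-- The paper's approximation `h̃(x, y)` of the expected beamforming-gain factor. -/
noncomputable def htilde (x y : ℝ) : ℝ :=
  (1 / Real.sqrt (2 * Real.pi * y * (Real.sin x) ^ 2)) *
    (1 + Real.exp (-2 * (Real.pi - x) ^ 2 / y))

/-- Monotonicity of the Gaussian-type profile that governs `htilde`. -/
theorem monotone_mul_one_add_exp_neg_sq :
    Monotone fun v : ℝ => v * (1 + Real.exp (-v ^ 2)) := by
  have hd (v : ℝ) : HasDerivAt (fun v : ℝ => v * (1 + Real.exp (-v ^ 2)))
      (1 * (1 + Real.exp (-v ^ 2)) + v * (Real.exp (-v ^ 2) * -(2 * v))) v := by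
    have h : HasDerivAt (fun v : ℝ => -v ^ 2) (-(2 * v)) v := by
      simpa using (hasDerivAt_pow 2 v).fun_neg
    exact (hasDerivAt_id v).fun_mul (h.exp.const_add 1)
  refine monotone_of_deriv_nonneg (fun v => (hd v).differentiableAt) fun v => ?_
  rw [(hd v).deriv]
  have hq := Real.quadratic_le_exp_of_nonneg (sq_nonneg v)
  have he : Real.exp (-v ^ 2) * Real.exp (v ^ 2) = 1 := by
    rw [← Real.exp_add, neg_add_cancel, Real.exp_zero]
  have hle : 0 ≤ Real.exp (v ^ 2) + 1 - 2 * v ^ 2 := by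
    nlinarith [sq_nonneg (v ^ 2 - 1)]
  calc (0 : ℝ) ≤ Real.exp (-v ^ 2) * (Real.exp (v ^ 2) + 1 - 2 * v ^ 2) :=
        mul_nonneg (Real.exp_pos _).le hle
    _ = _ := by linear_combination he

theorem htilde_pos {x y : ℝ} (hx : x ∈ Set.Ioo 0 Real.pi) (hy : 0 < y) : 0 < htilde x y := by
  have := Real.sin_pos_of_mem_Ioo hx
  have := Real.pi_pos
  unfold htilde
  positivity

theorem htilde_eq {x y : ℝ} (hx : x ∈ Set.Ioo 0 Real.pi) (hy : 0 < y) :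
    htilde x y = 1 / (2 * √Real.pi * Real.sin x * (Real.pi - x)) *
      (√2 * (Real.pi - x) / √y * (1 + Real.exp (-(√2 * (Real.pi - x) / √y) ^ 2))) := by
  have hs := Real.sin_pos_of_mem_Ioo hx
  have hp := Real.pi_pos
  have hx' : 0 < Real.pi - x := sub_pos.2 hx.2
  have hexp : -(√2 * (Real.pi - x) / √y) ^ 2 = -2 * (Real.pi - x) ^ 2 / y := by
    rw [div_pow, mul_pow, Real.sq_sqrt zero_le_two, Real.sq_sqrt hy.le]
    ring
  have h2 : √2 * √2 = (2 : ℝ) := Real.mul_self_sqrt zero_le_two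
  rw [hexp, htilde, Real.sqrt_mul (by positivity), Real.sqrt_mul (by positivity),
    Real.sqrt_mul zero_le_two, Real.sqrt_sq hs.le, ← mul_assoc]
  congr 1
  have hy' := Real.sqrt_pos.2 hy
  field_simp
  linear_combination -h2

/-- The approximation `htilde x y` is decreasing in the variance `y`. -/
theorem htilde_antitoneOn {x : ℝ} (hx : x ∈ Set.Ioo 0 Real.pi) :
    AntitoneOn (htilde x) (Set.Ioi 0) := by
  intro y hy z hz hyz
  have hs := Real.sin_pos_of_mem_Ioo hx
  have hx' : 0 < Real.pi - x := sub_pos.2 hx.2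
  have hy' := Real.sqrt_pos.2 (Set.mem_Ioi.1 hy)
  rw [htilde_eq hx hy, htilde_eq hx hz]
  refine mul_le_mul_of_nonneg_left (monotone_mul_one_add_exp_neg_sq ?_) (by positivity)
  gcongr

/-- Sensing shrinks the variance, hence increases `htilde`. -/
theorem htilde_le_htilde_posterior {x s A t : ℝ} (hx : x ∈ Set.Ioo 0 Real.pi) (hs : 0 < s)
    (hA : 0 < A) (ht : 0 ≤ t) : htilde x s ≤ htilde x (s * A / (s * t + A)) := by
  have hpos : 0 < s * t + A := by positivity
  refine htilde_antitoneOn hx (Set.mem_Ioi.2 (by positivity)) hs ?_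
  rw [div_le_iff₀ hpos]
  nlinarith [mul_nonneg hs.le (mul_nonneg hs.le ht)]


/-- Remark 2: the joint-S&C-stage rate never exceeds the communication-only-stage rate,
i.e. `R^{S&C} ≤ R̃^C(t)` for every reflecting ratio `β ∈ [0,1]` and sensing resource `t ≥ 0`. -/
theorem stmt6 (φ ϕ : ℝ) (hφ : φ ∈ Set.Ioo 0 Real.pi) (hϕ : ϕ ∈ Set.Ioo 0 Real.pi)
    (σφ2 σϕ2 Aφ Aϕ C : ℝ) (hσφ : 0 < σφ2) (hσϕ : 0 < σϕ2)
    (hAφ : 0 < Aφ) (hAϕ : 0 < Aϕ) (hC : 0 < C) :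
    ∀ β ∈ Set.Icc (0:ℝ) 1, ∀ t : ℝ, 0 ≤ t →
      Real.logb 2 (1 + C * (1 - β) * htilde φ σφ2 * htilde ϕ σϕ2) ≤
      Real.logb 2 (1 + C * htilde φ (σφ2 * Aφ / (σφ2 * t + Aφ))
        * htilde ϕ (σϕ2 * Aϕ / (σϕ2 * t + Aϕ))) := by
  intro β hβ t ht
  have hφ0 := htilde_pos hφ hσφ
  have hϕ0 := htilde_pos hϕ hσϕ
  have hφ1 := htilde_le_htilde_posterior hφ hσφ hAφ ht
  have hϕ1 := htilde_le_htilde_posterior hϕ hσϕ hAϕ ht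
  have hβ0 : 0 ≤ 1 - β := sub_nonneg.2 hβ.2
  have hβ1 : C * (1 - β) ≤ C := mul_le_of_le_one_right hC.le (sub_le_self 1 hβ.1)
  have hφ2 := hφ0.trans_le hφ1
  refine Real.logb_le_logb_of_le one_lt_two (by positivity) ?_
  gcongr
end

section
/- Let φ ∈ (0, π), σ > 0, and let M be a fixed positive integer. Let ω be a real Gaussian random variable with mean 0 and variance σ², and for a positive integer L define the Fejér kernel F_L(x) = (1/L)·(sin(Lπx/2)/sin(πx/2))² for x not an even integer, and F_L(x) = L for x an even integer (similarly F_M). Then lim_{L→∞} E[ F_L( cos(φ + ω) − cos φ ) · F_M( cos(φ + ω) − cos φ ) ] = 2·M·h(φ, σ²), where h(x, y) = (1/√(2π·y·sin²x)) · ∑_{i ∈ ℤ} ( exp(−2(iπ)²/y) + exp(−2((i+1)π − x)²/y) ). -/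
open MeasureTheory ProbabilityTheory Filter
open scoped Classical

/-- The Fejér kernel: `F_L(x) = (1/L)·(sin(Lπx/2)/sin(πx/2))²` for `x` not an even
integer, and `F_L(x) = L` for `x` an even integer. -/
noncomputable def fejer (L : ℕ) (x : ℝ) : ℝ :=
  if ∃ k : ℤ, x = 2 * k then (L : ℝ)
  else (1 / L) * (Real.sin (L * Real.pi * x / 2) / Real.sin (Real.pi * x / 2)) ^ 2

/-- The wrapped-Gaussian factor `h(x, y)` of the paper. -/
noncomputable def hfun (x y : ℝ) : ℝ :=
  (1 / Real.sqrt (2 * Real.pi * y * (Real.sin x) ^ 2)) *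
    ∑' i : ℤ, (Real.exp (-2 * ((i : ℝ) * Real.pi) ^ 2 / y) +
      Real.exp (-2 * (((i : ℝ) + 1) * Real.pi - x) ^ 2 / y))
theorem fejer_eq_trigPoly (L : ℕ) (x : ℝ) :
    fejer L x = (1 / L) * ∑ j ∈ Finset.range L, ∑ k ∈ Finset.range L,
      Real.cos (Real.pi * ((j : ℝ) - k) * x) := by
  have hsq : ∑ j ∈ Finset.range L, ∑ k ∈ Finset.range L, Real.cos (Real.pi * ((j : ℝ) - k) * x) =
      (∑ k ∈ Finset.range L, Real.cos (2 * k * (Real.pi * x / 2))) ^ 2 +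
        (∑ k ∈ Finset.range L, Real.sin (2 * k * (Real.pi * x / 2))) ^ 2 := by
    simp only [sq, Finset.sum_mul_sum, ← Finset.sum_add_distrib, ← Real.cos_sub]
    refine Finset.sum_congr rfl fun j _ => Finset.sum_congr rfl fun k _ => ?_
    congr 1
    ring
  rw [hsq, fejer]
  split_ifs with h
  · obtain ⟨m, rfl⟩ := h
    have e (k : ℕ) : 2 * (k : ℝ) * (Real.pi * (2 * m) / 2) = ((k * m : ℤ) : ℝ) * (2 * Real.pi) := by
      push_cast
      ring
    have e' (k : ℕ) : 2 * (k : ℝ) * (Real.pi * (2 * m) / 2) = ((2 * k * m : ℤ) : ℝ) * Real.pi := by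
      push_cast
      ring
    have hc : ∑ k ∈ Finset.range L, Real.cos (2 * k * (Real.pi * (2 * m) / 2)) = L := by
      simp only [e, Real.cos_int_mul_two_pi]
      simp
    have hs : ∑ k ∈ Finset.range L, Real.sin (2 * k * (Real.pi * (2 * m) / 2)) = 0 := by
      simp only [e', Real.sin_int_mul_pi]
      simp
    rw [hc, hs]
    rcases eq_or_ne (L : ℝ) 0 with h0 | h0
    · simp [h0]
    · field_simp
      ring
  · set a := Real.pi * x / 2 with ha
    have hsin : Real.sin a ≠ 0 := by
      intro h0
      obtain ⟨n, hn⟩ := Real.sin_eq_zero_iff.1 h0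
      refine h ⟨n, ?_⟩
      have := Real.pi_ne_zero
      rw [ha] at hn
      field_simp at hn
      linarith
    have hc (N : ℕ) : Real.sin a * ∑ k ∈ Finset.range N, Real.cos (2 * k * a) =
        Real.sin (N * a) * Real.cos (N * a - a) := by
      induction N with
      | zero => simp
      | succ N ih =>
        have e1 : ((N + 1 : ℕ) : ℝ) * a = N * a + a := by push_cast; ring
        rw [Finset.sum_range_succ, mul_add, ih, e1, mul_assoc 2, Real.cos_two_mul',
          add_sub_cancel_right, Real.cos_sub, Real.sin_add]
        ring
    have hs (N : ℕ) : Real.sin a * ∑ k ∈ Finset.range N, Real.sin (2 * k * a) =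
        Real.sin (N * a) * Real.sin (N * a - a) := by
      induction N with
      | zero => simp
      | succ N ih =>
        have e1 : ((N + 1 : ℕ) : ℝ) * a = N * a + a := by push_cast; ring
        rw [Finset.sum_range_succ, mul_add, ih, e1, mul_assoc 2, Real.sin_two_mul,
          add_sub_cancel_right, Real.sin_sub, Real.sin_add]
        ring
    have hmul : Real.sin a ^ 2 * ((∑ k ∈ Finset.range L, Real.cos (2 * k * a)) ^ 2 +
        (∑ k ∈ Finset.range L, Real.sin (2 * k * a)) ^ 2) = Real.sin (L * a) ^ 2 := by
      rw [mul_add, ← mul_pow, ← mul_pow, hc, hs, mul_pow, mul_pow, ← mul_add,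
        Real.cos_sq_add_sin_sq, mul_one]
    have e2 : (L : ℝ) * Real.pi * x / 2 = L * a := by rw [ha]; ring
    rw [e2, div_pow, ← hmul, mul_div_cancel_left₀ _ (pow_ne_zero 2 hsin)]

theorem continuous_fejer (L : ℕ) : Continuous (fejer L) := by
  rw [funext (fejer_eq_trigPoly L)]
  fun_prop

theorem fejer_nonneg (L : ℕ) (x : ℝ) : 0 ≤ fejer L x := by
  rw [fejer]
  split_ifs <;> positivity

theorem fejer_le (L : ℕ) (x : ℝ) : fejer L x ≤ L := by
  rw [fejer_eq_trigPoly]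
  have h : ∑ j ∈ Finset.range L, ∑ k ∈ Finset.range L, Real.cos (Real.pi * ((j : ℝ) - k) * x) ≤
      ∑ j ∈ Finset.range L, ∑ k ∈ Finset.range L, (1 : ℝ) :=
    Finset.sum_le_sum fun j _ => Finset.sum_le_sum fun k _ => Real.cos_le_one _
  simp only [Finset.sum_const, Finset.card_range, nsmul_eq_mul, mul_one] at h
  calc _ ≤ 1 / (L : ℝ) * (L * L) := by gcongr
    _ ≤ L := by
      rcases eq_or_ne (L : ℝ) 0 with h0 | h0
      · simp [h0]
      · field_simp
        rfl

@[simp]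
theorem fejer_zero (L : ℕ) : fejer L 0 = L := if_pos ⟨0, by simp⟩

theorem fejer_le_inv (L : ℕ) {x : ℝ} (hx : Real.sin (Real.pi * x / 2) ≠ 0) :
    fejer L x ≤ 1 / (L * Real.sin (Real.pi * x / 2) ^ 2) := by
  have hk : ¬ ∃ k : ℤ, x = 2 * k := by
    rintro ⟨k, rfl⟩
    refine hx ?_
    rw [show Real.pi * (2 * k) / 2 = k * Real.pi by ring, Real.sin_int_mul_pi]
  rw [fejer, if_neg hk, div_pow, one_div_mul_eq_div, div_div, mul_comm (_ ^ 2) (L : ℝ)]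
  gcongr
  exact Real.sin_sq_le_one _

theorem integral_fejer {L : ℕ} (hL : L ≠ 0) (c : ℝ) : ∫ x in (-1 - c)..(1 - c), fejer L x = 2 := by
  have hterm (j k : ℕ) : ∫ x in (-1 - c)..(1 - c), Real.cos (Real.pi * ((j : ℝ) - k) * x) =
      if j = k then 2 else 0 := by
    split_ifs with h
    · subst h
      simp
      norm_num
    · have hjk : Real.pi * ((j : ℝ) - k) ≠ 0 :=
        mul_ne_zero Real.pi_ne_zero (sub_ne_zero.2 (by exact_mod_cast h))
      rw [intervalIntegral.integral_comp_mul_left (fun x => Real.cos x) hjk, integral_cos]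
      have e : Real.pi * ((j : ℝ) - k) * (1 - c) =
          Real.pi * ((j : ℝ) - k) * (-1 - c) + ((j - k : ℤ) : ℝ) * (2 * Real.pi) := by
        push_cast
        ring
      rw [e, Real.sin_add_int_mul_two_pi, sub_self, smul_zero]
  simp only [fejer_eq_trigPoly]
  rw [intervalIntegral.integral_const_mul, intervalIntegral.integral_finsetSum]
  · have (j : ℕ) : ∫ x in (-1 - c)..(1 - c), ∑ k ∈ Finset.range L,
        Real.cos (Real.pi * ((j : ℝ) - k) * x) = ∑ k ∈ Finset.range L, if j = k then (2 : ℝ) else 0 := by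
      rw [intervalIntegral.integral_finsetSum]
      · simp only [hterm]
      · intro k _
        exact Continuous.intervalIntegrable (by fun_prop) _ _
    simp only [this, Finset.sum_ite_eq]
    rw [Finset.sum_congr rfl fun j hj => if_pos hj]
    have : (L : ℝ) ≠ 0 := by exact_mod_cast hL
    simp
    field_simp
  · intro k _
    exact Continuous.intervalIntegrable (by fun_prop) _ _

theorem sin_half_pi_mul_cos_sub_cos_ne_zero {φ t : ℝ} (hφ : φ ∈ Set.Ioo 0 Real.pi)
    (ht : t ∈ Set.Icc 0 Real.pi) (hne : t ≠ φ) :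
    Real.sin (Real.pi * (Real.cos t - Real.cos φ) / 2) ≠ 0 := by
  have hcne : Real.cos t - Real.cos φ ≠ 0 := fun h =>
    hne (Real.injOn_cos ht (Set.Ioo_subset_Icc_self hφ) (sub_eq_zero.1 h))
  have h1 : Real.cos φ < 1 := by
    simpa using Real.cos_lt_cos_of_nonneg_of_le_pi le_rfl hφ.2.le hφ.1
  have h2 : -1 < Real.cos φ := by
    simpa using Real.cos_lt_cos_of_nonneg_of_le_pi hφ.1.le le_rfl hφ.2
  have h3 := Real.cos_le_one t
  have h4 := Real.neg_one_le_cos t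
  have hpi := Real.pi_pos
  rw [Ne, Real.sin_eq_zero_iff_of_lt_of_lt (by nlinarith) (by nlinarith)]
  have := mul_ne_zero hpi.ne' hcne
  simpa using this

theorem tendstoUniformlyOn_fejer_cos {φ : ℝ} (hφ : φ ∈ Set.Ioo 0 Real.pi) {u : Set ℝ}
    (hu : IsOpen u) (hφu : φ ∈ u) :
    TendstoUniformlyOn (fun (L : ℕ) t => fejer L (Real.cos t - Real.cos φ)) 0 atTop
      (Set.Icc 0 Real.pi \ u) := by
  have hK : IsCompact (Set.Icc 0 Real.pi \ u) := isCompact_Icc.diff hu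
  obtain ⟨δ, hδ, hle⟩ := hK.exists_forall_le' (a := 0)
    (f := fun t => Real.sin (Real.pi * (Real.cos t - Real.cos φ) / 2) ^ 2) (by fun_prop)
    (fun t ht => by
      have := sin_half_pi_mul_cos_sub_cos_ne_zero hφ ht.1 (fun h => ht.2 (h ▸ hφu))
      positivity)
  rw [Metric.tendstoUniformlyOn_iff]
  intro ε hε
  have hlim : Tendsto (fun L : ℕ => 1 / ((L : ℝ) * δ)) atTop (nhds 0) := by
    simp only [one_div]
    exact (tendsto_natCast_atTop_atTop.atTop_mul_const hδ).inv_tendsto_atTop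
  filter_upwards [hlim.eventually_lt_const hε, eventually_gt_atTop 0] with L hL hL0 t ht
  have hL0' : (0 : ℝ) < L := by exact_mod_cast hL0
  rw [Pi.zero_apply, dist_comm, Real.dist_eq, sub_zero, abs_of_nonneg (fejer_nonneg _ _)]
  refine (fejer_le_inv L
    (sin_half_pi_mul_cos_sub_cos_ne_zero hφ ht.1 fun h => ht.2 (h ▸ hφu))).trans_lt
    (lt_of_le_of_lt ?_ hL)
  have := hle t ht
  gcongr

theorem integral_sin_mul_fejer_cos {L : ℕ} (hL : L ≠ 0) (c : ℝ) :
    ∫ t in (0 : ℝ)..Real.pi, Real.sin t * fejer L (Real.cos t - c) = 2 := by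
  have h := intervalIntegral.integral_comp_mul_deriv (a := 0) (b := Real.pi)
    (f := fun t => Real.cos t - c) (f' := fun t => -Real.sin t)
    (fun t _ => (Real.hasDerivAt_cos t).sub_const c) (by fun_prop) (continuous_fejer L)
  simp only [Function.comp_apply, Real.cos_zero, Real.cos_pi, mul_neg,
    intervalIntegral.integral_neg] at h
  rw [← integral_fejer hL c, intervalIntegral.integral_symm (1 - c) (-1 - c), ← h, neg_neg]
  simp only [mul_comm]

/-- The Fejér kernels `fejer L (cos t - cos φ)` concentrate at `t = φ`, with weight `2 / sin φ`. -/
theorem tendsto_integral_fejer_cos_mul {φ : ℝ} (hφ : φ ∈ Set.Ioo 0 Real.pi) {K : ℝ → ℝ}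
    (hK : ContinuousOn K (Set.Icc 0 Real.pi)) :
    Tendsto (fun L : ℕ => ∫ t in Set.Ioc 0 Real.pi, fejer L (Real.cos t - Real.cos φ) * K t)
      atTop (nhds (2 * K φ / Real.sin φ)) := by
  set w : ℝ → NNReal := fun t => Real.toNNReal (Real.sin t / 2) with hw
  have hwm : Measurable w := by fun_prop
  have hsinpos {t : ℝ} (ht : t ∈ Set.Ioo 0 Real.pi) : 0 < Real.sin t := Real.sin_pos_of_mem_Ioo ht
  have hwt {t : ℝ} (ht : t ∈ Set.Ioo 0 Real.pi) : (w t : ℝ) = Real.sin t / 2 :=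
    Real.coe_toNNReal _ (by have := hsinpos ht; positivity)
  set μ : Measure ℝ := volume.withDensity fun t => (w t : ENNReal) with hμ
  have hμr : μ.restrict (Set.Ioo 0 Real.pi) =
      (volume.restrict (Set.Ioo 0 Real.pi)).withDensity fun t => (w t : ENNReal) :=
    restrict_withDensity measurableSet_Ioo _
  have hint (f : ℝ → ℝ) : ∫ t in Set.Ioo 0 Real.pi, f t ∂μ =
      ∫ t in Set.Ioo 0 Real.pi, Real.sin t / 2 * f t := by
    rw [hμr, integral_withDensity_eq_integral_smul hwm]
    refine setIntegral_congr_fun measurableSet_Ioo fun t ht => ?_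
    simp only [NNReal.smul_def, hwt ht, smul_eq_mul]
  have hμfin : μ (Set.Ioo 0 Real.pi) ≠ ⊤ := by
    rw [hμ, withDensity_apply _ measurableSet_Ioo]
    refine ne_top_of_le_ne_top (b := ∫⁻ t in Set.Ioo 0 Real.pi, 1) (by simp) ?_
    refine lintegral_mono fun t => ?_
    simp only [hw, ENNReal.coe_le_one_iff, Real.toNNReal_le_one]
    linarith [Real.sin_le_one t]
  have key := tendsto_setIntegral_peak_smul_of_integrableOn_of_tendsto (μ := μ)
    (s := Set.Ioo 0 Real.pi) (t := Set.Ioo 0 Real.pi) (x₀ := φ) (l := atTop)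
    (φ := fun (L : ℕ) t => fejer L (Real.cos t - Real.cos φ))
    (g := fun t => 2 * K t / Real.sin t) (a := 2 * K φ / Real.sin φ)
    measurableSet_Ioo measurableSet_Ioo subset_rfl self_mem_nhdsWithin hμfin
    (Eventually.of_forall fun L t _ => fejer_nonneg _ _)
    (fun u hu hφu => (tendstoUniformlyOn_fejer_cos hφ hu hφu).mono
      (Set.sdiff_subset_sdiff_left Set.Ioo_subset_Icc_self))
    ?_ (Eventually.of_forall fun L => ?_) ?_ ?_
  · refine key.congr fun L => ?_
    rw [hint, integral_Ioc_eq_integral_Ioo]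
    refine setIntegral_congr_fun measurableSet_Ioo fun t ht => ?_
    have := (hsinpos ht).ne'
    simp only [smul_eq_mul]
    field_simp
  · refine tendsto_const_nhds.congr' ?_
    filter_upwards [eventually_ne_atTop 0] with L hL
    have h := integral_sin_mul_fejer_cos hL (Real.cos φ)
    rw [intervalIntegral.integral_of_le Real.pi_pos.le, integral_Ioc_eq_integral_Ioo] at h
    rw [hint]
    simp only [div_mul_eq_mul_div, integral_div, h]
    norm_num
  · exact ((continuous_fejer L).comp (by fun_prop)).aestronglyMeasurable
  · rw [IntegrableOn, hμr, integrable_withDensity_iff_integrable_smul hwm]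
    refine IntegrableOn.congr_fun (hK.integrableOn_Icc.mono_set Set.Ioo_subset_Icc_self)
      (fun t ht => ?_) measurableSet_Ioo
    have := (hsinpos ht).ne'
    simp only [NNReal.smul_def, hwt ht, smul_eq_mul]
    field_simp
  · have hKφ : ContinuousAt K φ := hK.continuousAt (Icc_mem_nhds hφ.1 hφ.2)
    exact (((continuousAt_const.mul hKφ).div Real.continuous_sin.continuousAt
      (hsinpos hφ).ne').tendsto).mono_left nhdsWithin_le_nhds

/-- Folding an integral over `ℝ` onto `[0, π]` along the group generated by `x ↦ x + 2π` and
`x ↦ -x`. -/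
theorem hasSum_integral_fold {q : ℝ → ℝ} (hq : Integrable q) :
    HasSum (fun k : ℤ => ∫ t in Set.Ioc 0 Real.pi,
      (q (2 * Real.pi * k + t) + q (2 * Real.pi * (k + 1) - t))) (∫ x, q x) := by
  have h2pi : 0 < 2 * Real.pi := by positivity
  have h := hasSum_integral_iUnion (f := q) (μ := volume)
    (s := fun k : ℤ => Set.Ioc (k • (2 * Real.pi)) ((k + 1) • (2 * Real.pi)))
    (fun _ => measurableSet_Ioc) (Set.pairwise_disjoint_Ioc_zsmul (2 * Real.pi)) hq.integrableOn
  rw [iUnion_Ioc_zsmul h2pi, setIntegral_univ] at h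
  convert! h using 1
  funext k
  have hI (a b : ℝ) : IntervalIntegrable q volume a b := hq.intervalIntegrable
  have e1 : k • (2 * Real.pi) = 2 * Real.pi * k + 0 := by simp [mul_comm]
  have e2 : (k + 1) • (2 * Real.pi) = 2 * Real.pi * (k + 1) - 0 := by simp [mul_comm]
  rw [← intervalIntegral.integral_of_le Real.pi_pos.le,
    ← intervalIntegral.integral_of_le (by gcongr; omega), e1, e2, intervalIntegral.integral_add,
    intervalIntegral.integral_comp_add_left (fun x => q x),
    intervalIntegral.integral_comp_sub_left (fun x => q x),
    show 2 * Real.pi * ((k : ℝ) + 1) - Real.pi = 2 * Real.pi * k + Real.pi by ring,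
    intervalIntegral.integral_add_adjacent_intervals (hI _ _) (hI _ _)]
  · exact (hq.comp_add_left _).intervalIntegrable
  · exact (hq.comp_sub_left _).intervalIntegrable

theorem gaussianPDFReal_zero_le_exp_neg_abs {v : NNReal} (hv : v ≠ 0) (x : ℝ) :
    gaussianPDFReal 0 v x ≤ (Real.sqrt (2 * Real.pi * v))⁻¹ * Real.exp (v / 2) * Real.exp (-|x|) := by
  have hv' : (0 : ℝ) < v := by positivity
  rw [gaussianPDFReal, mul_assoc _ (Real.exp _), ← Real.exp_add, sub_zero]
  gcongr
  rw [div_le_iff₀ (by positivity), ← sq_abs x]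
  nlinarith [sq_nonneg (|x| - v)]

theorem summable_exp_neg_abs_int : Summable fun k : ℤ => Real.exp (-|(k : ℝ)|) := by
  refine Summable.of_nat_of_neg ?_ ?_ <;> simpa using Real.summable_exp_neg_nat

/-- The Gaussian density centred at `φ`, folded onto `[0, π]`. -/
noncomputable def foldedGaussian (v : NNReal) (φ : ℝ) (k : ℤ) (t : ℝ) : ℝ :=
  gaussianPDFReal 0 v (2 * Real.pi * k + t - φ) +
    gaussianPDFReal 0 v (2 * Real.pi * (k + 1) - t - φ)

theorem foldedGaussian_nonneg (v : NNReal) (φ : ℝ) (k : ℤ) (t : ℝ) :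
    0 ≤ foldedGaussian v φ k t :=
  add_nonneg (gaussianPDFReal_nonneg _ _ _) (gaussianPDFReal_nonneg _ _ _)

theorem continuous_foldedGaussian (v : NNReal) (φ : ℝ) (k : ℤ) :
    Continuous (foldedGaussian v φ k) := by
  unfold foldedGaussian gaussianPDFReal
  fun_prop

theorem exists_summable_bound_foldedGaussian {v : NNReal} (hv : v ≠ 0) {φ : ℝ}
    (hφ : φ ∈ Set.Icc 0 Real.pi) :
    ∃ b : ℤ → ℝ, Summable b ∧
      ∀ k, ∀ t ∈ Set.Icc 0 Real.pi, foldedGaussian v φ k t ≤ b k := by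
  set C := (Real.sqrt (2 * Real.pi * v))⁻¹ * Real.exp (v / 2) with hC
  have hC0 : 0 ≤ C := by positivity
  refine ⟨fun k => 2 * (C * Real.exp (2 * Real.pi)) * Real.exp (-|(k : ℝ)|),
    summable_exp_neg_abs_int.mul_left _, fun k t ht => ?_⟩
  have hbound (d : ℝ) (hd : |d| ≤ 2 * Real.pi) :
      gaussianPDFReal 0 v (2 * Real.pi * k + d) ≤
        C * Real.exp (2 * Real.pi) * Real.exp (-|(k : ℝ)|) := by
    refine (gaussianPDFReal_zero_le_exp_neg_abs hv _).trans ?_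
    rw [← hC, mul_assoc C, ← Real.exp_add]
    refine mul_le_mul_of_nonneg_left (Real.exp_le_exp.2 ?_) hC0
    have h1 : |2 * Real.pi * k| - |d| ≤ |2 * Real.pi * k + d| := by
      simpa using abs_sub_abs_le_abs_sub (2 * Real.pi * k) (-d)
    rw [abs_mul, abs_of_pos (by positivity : 0 < 2 * Real.pi)] at h1
    nlinarith [abs_nonneg (k : ℝ), Real.pi_gt_three]
  have h1 := hbound (t - φ) (abs_le.2 ⟨by linarith [ht.1, hφ.2, Real.pi_pos],
    by linarith [ht.2, hφ.1, Real.pi_pos]⟩)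
  have h2 := hbound (2 * Real.pi - t - φ) (abs_le.2 ⟨by linarith [ht.2, hφ.2, Real.pi_pos],
    by linarith [ht.1, hφ.1, Real.pi_pos]⟩)
  rw [foldedGaussian, show 2 * Real.pi * k + t - φ = 2 * Real.pi * k + (t - φ) by ring,
    show 2 * Real.pi * ((k : ℝ) + 1) - t - φ = 2 * Real.pi * k + (2 * Real.pi - t - φ) by ring]
  linarith

theorem summable_foldedGaussian {v : NNReal} (hv : v ≠ 0) {φ t : ℝ}
    (hφ : φ ∈ Set.Icc 0 Real.pi) (ht : t ∈ Set.Icc 0 Real.pi) :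
    Summable fun k => foldedGaussian v φ k t := by
  obtain ⟨b, hb, hle⟩ := exists_summable_bound_foldedGaussian hv hφ
  exact hb.of_nonneg_of_le (fun k => foldedGaussian_nonneg v φ k t) fun k => hle k t ht

theorem continuousOn_tsum_foldedGaussian {v : NNReal} (hv : v ≠ 0) {φ : ℝ}
    (hφ : φ ∈ Set.Icc 0 Real.pi) :
    ContinuousOn (fun t => ∑' k, foldedGaussian v φ k t) (Set.Icc 0 Real.pi) := by
  obtain ⟨b, hb, hle⟩ := exists_summable_bound_foldedGaussian hv hφ
  refine continuousOn_tsum (fun k => (continuous_foldedGaussian v φ k).continuousOn) hb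
    fun k t ht => ?_
  rw [Real.norm_of_nonneg (foldedGaussian_nonneg v φ k t)]
  exact hle k t ht

theorem integral_comp_cos_gaussianReal {v : NNReal} (hv : v ≠ 0) {φ : ℝ}
    (hφ : φ ∈ Set.Icc 0 Real.pi) {f : ℝ → ℝ} (hf : Continuous f) {B : ℝ} (hB : ∀ x, ‖f x‖ ≤ B) :
    ∫ ω, f (Real.cos (φ + ω)) ∂(gaussianReal 0 v) =
      ∫ t in Set.Ioc 0 Real.pi, f (Real.cos t) * ∑' k, foldedGaussian v φ k t := by
  have hB0 : 0 ≤ B := (norm_nonneg _).trans (hB 0)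
  set q : ℝ → ℝ := fun θ => f (Real.cos θ) * gaussianPDFReal 0 v (θ - φ) with hq
  have hqi : Integrable q :=
    ((integrable_gaussianPDFReal 0 v).comp_sub_right φ).bdd_mul (c := B)
      (hf.comp Real.continuous_cos).aestronglyMeasurable (Eventually.of_forall fun x => hB _)
  have hlhs : ∫ ω, f (Real.cos (φ + ω)) ∂(gaussianReal 0 v) = ∫ θ, q θ := by
    rw [integral_gaussianReal_eq_integral_smul hv, ← integral_add_left_eq_self q φ]
    simp only [hq, smul_eq_mul, add_sub_cancel_left, mul_comm]
  have hfold (k : ℤ) (t : ℝ) : q (2 * Real.pi * k + t) + q (2 * Real.pi * (k + 1) - t) =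
      f (Real.cos t) * foldedGaussian v φ k t := by
    have e1 : Real.cos (2 * Real.pi * k + t) = Real.cos t := by
      rw [← Real.cos_add_int_mul_two_pi t k]
      congr 1
      ring
    have e2 : Real.cos (2 * Real.pi * (k + 1) - t) = Real.cos t := by
      rw [← Real.cos_int_mul_two_pi_sub t (k + 1)]
      congr 1
      push_cast
      ring
    simp only [hq, e1, e2, foldedGaussian]
    rw [mul_add (f _)]
  have hsum := hasSum_integral_fold hqi
  simp only [hfold] at hsum
  obtain ⟨b, hb, hle⟩ := exists_summable_bound_foldedGaussian hv hφ
  have hmem : ∀ᵐ t ∂volume.restrict (Set.Ioc 0 Real.pi), t ∈ Set.Icc 0 Real.pi :=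
    (ae_restrict_mem measurableSet_Ioc).mono fun t ht => Set.Ioc_subset_Icc_self ht
  rw [hlhs]
  refine hsum.unique (hasSum_integral_of_dominated_convergence (fun k _ => B * b k)
    (fun k => ((hf.comp Real.continuous_cos).mul
      (continuous_foldedGaussian v φ k)).aestronglyMeasurable)
    (fun k => hmem.mono fun t ht => ?_) (Eventually.of_forall fun _ => hb.mul_left B)
    (integrable_const _)
    (hmem.mono fun t ht => (summable_foldedGaussian hv hφ ht).hasSum.mul_left _))
  rw [norm_mul, Real.norm_of_nonneg (foldedGaussian_nonneg v φ k t)]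
  exact mul_le_mul (hB _) (hle k t ht) (foldedGaussian_nonneg v φ k t) hB0

theorem tsum_foldedGaussian_self_div_sin (v : NNReal) {φ : ℝ} (hφ : φ ∈ Set.Ioo 0 Real.pi) :
    (∑' k, foldedGaussian v φ k φ) / Real.sin φ = hfun φ v := by
  have hs : 0 < Real.sin φ := Real.sin_pos_of_mem_Ioo hφ
  rw [hfun, Real.sqrt_mul' _ (sq_nonneg _), Real.sqrt_sq hs.le, ← tsum_mul_left, ← tsum_div_const]
  refine tsum_congr fun k => ?_
  have e (a b : ℝ) (h : a = 2 * b) : -a ^ 2 / (2 * (v : ℝ)) = -2 * b ^ 2 / v := by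
    rw [h, ← mul_div_mul_left (-2 * b ^ 2) (v : ℝ) two_ne_zero]
    ring
  rw [foldedGaussian, gaussianPDFReal, gaussianPDFReal, sub_zero, sub_zero, add_sub_cancel_right,
    e _ ((k : ℝ) * Real.pi) (by ring), e _ (((k : ℝ) + 1) * Real.pi - φ) (by ring)]
  ring

/-- Combined transmit-array and IOS beamforming gain limit (Proposition 2): for
`ω ~ N(0, σ²)` and fixed `M ≥ 1`,
`lim_{L→∞} E[F_L(cos(φ+ω) − cos φ)·F_M(cos(φ+ω) − cos φ)] = 2·M·h(φ, σ²)`. -/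
theorem stmt13 (φ σ : ℝ) (hφ : φ ∈ Set.Ioo 0 Real.pi) (hσ : 0 < σ)
    (M : ℕ) (hM : 1 ≤ M) :
    Tendsto (fun L : ℕ =>
        ∫ ω, fejer L (Real.cos (φ + ω) - Real.cos φ) *
            fejer M (Real.cos (φ + ω) - Real.cos φ)
          ∂(gaussianReal 0 ⟨σ ^ 2, sq_nonneg σ⟩))
      atTop (nhds (2 * (M : ℝ) * hfun φ (σ ^ 2))) := by
  set v : NNReal := ⟨σ ^ 2, sq_nonneg σ⟩
  have hv0 : v ≠ 0 := fun h => (pow_pos hσ 2).ne' (congrArg NNReal.toReal h)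
  have hφ' := Set.Ioo_subset_Icc_self hφ
  have habs (N : ℕ) (x : ℝ) : ‖fejer N x‖ ≤ N := by
    rw [Real.norm_of_nonneg (fejer_nonneg N x)]
    exact fejer_le N x
  have hlim := tendsto_integral_fejer_cos_mul hφ
    (K := fun t => fejer M (Real.cos t - Real.cos φ) * ∑' k, foldedGaussian v φ k t)
    (((continuous_fejer M).comp (by fun_prop)).continuousOn.mul
      (continuousOn_tsum_foldedGaussian hv0 hφ'))
  rw [show σ ^ 2 = (v : ℝ) from rfl, ← tsum_foldedGaussian_self_div_sin v hφ]
  convert hlim using 2 with L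
  · rw [integral_comp_cos_gaussianReal hv0 hφ'
      (f := fun c => fejer L (c - Real.cos φ) * fejer M (c - Real.cos φ))
      (((continuous_fejer L).comp (by fun_prop)).mul ((continuous_fejer M).comp (by fun_prop)))
      (B := L * M) fun x => by
        rw [norm_mul]
        exact mul_le_mul (habs L _) (habs M _) (norm_nonneg _) (Nat.cast_nonneg L)]
    simp only [mul_assoc]
  · rw [sub_self, fejer_zero]
    ring
end
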